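/- Let u ∈ ℓ²(ℕ, ℂ) and let u♯ be the sequence u♯(n) = conj(u(n)). Then the adjoint of the maximal Hankel operator Γ_u is the maximal Hankel operator Γ_{u♯}: for f, h ∈ ℓ², one has ⟨Γ_u g, f⟩ = ⟨g, h⟩ for all g ∈ Dom Γ_u if and only if f ∈ Dom Γ_{u♯} and Γ_{u♯} f = h. -/

import Mathlib

open scoped ComplexConjugate
open Filter

noncomputable section

/-- `ℓ²(ℕ, ℂ)`. -/
abbrev ellTwo : Type := lp (fun _ : ℕ => ℂ) 2

/-- The (maximal) Hankel matrix action with symbol `u`: `(Γ_u f)(m) = ∑_{n} u(n+m) f(n)`. -/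
def hankel (u f : ℕ → ℂ) : ℕ → ℂ := fun m => ∑' n : ℕ, u (n + m) * f n

/-- The `ℓ²` inner product, linear in the first argument. -/
def ip (f g : ℕ → ℂ) : ℂ := ∑' n : ℕ, f n * conj (g n)

/-- `u♯(n) = conj (u n)`. -/
def sharp (u : ℕ → ℂ) : ℕ → ℂ := fun n => conj (u n)

/-- The formal power series with the coefficients of an element of `ℓ²(ℕ, ℂ)`. -/
def powerSeries (x : ellTwo) : PowerSeries ℂ := PowerSeries.mk x

theorem coeff_powerSeries (x : ellTwo) (n : ℕ) :
    PowerSeries.coeff n (powerSeries x) = x n := by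
  simp [powerSeries]

theorem powerSeries_injective : Function.Injective powerSeries := by
  intro x y hxy
  ext n
  rw [← coeff_powerSeries, hxy, coeff_powerSeries]

theorem powerSeries_smul (c : ℂ) (x : ellTwo) : powerSeries (c • x) = c • powerSeries x := rfl

theorem summable_norm_sq (x : ellTwo) : Summable fun n => ‖x n‖ ^ (2 : ℝ) := by
  simpa using (lp.memℓp x).summable (by norm_num)

theorem norm_sq_eq_tsum (x : ellTwo) : ‖x‖ ^ (2 : ℝ) = ∑' n, ‖x n‖ ^ (2 : ℝ) := by
  simpa using lp.norm_rpow_eq_tsum (p := 2) (by norm_num) x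

/-- The forward shift on sequences. -/
def shiftFun (x : ℕ → ℂ) : ℕ → ℂ
  | 0 => 0
  | n + 1 => x n

theorem memℓp_shiftFun (x : ellTwo) : Memℓp (shiftFun x) 2 := by
  rw [memℓp_gen_iff (by norm_num)]
  refine (summable_nat_add_iff 1).1 ?_
  simpa [shiftFun] using summable_norm_sq x

/-- The forward shift on `ℓ²(ℕ, ℂ)`. -/
def shift : ellTwo →ₗᵢ[ℂ] ellTwo where
  toFun x := ⟨shiftFun x, memℓp_shiftFun x⟩
  map_add' x y := by
    ext n
    cases n
    · exact (add_zero 0).symm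
    · rfl
  map_smul' c x := by
    ext n
    cases n <;> simp [shiftFun]
  norm_map' x := by
    have h : ‖(⟨shiftFun x, memℓp_shiftFun x⟩ : ellTwo)‖ ^ (2 : ℝ) = ‖x‖ ^ (2 : ℝ) := by
      rw [norm_sq_eq_tsum, norm_sq_eq_tsum, (summable_norm_sq _).tsum_eq_zero_add]
      simp [shiftFun]
    exact (Real.rpow_left_inj (norm_nonneg _) (norm_nonneg _) two_ne_zero).1 h

theorem powerSeries_shift (x : ellTwo) :
    powerSeries (shift x) = PowerSeries.X * powerSeries x := by
  ext n
  rw [coeff_powerSeries]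
  cases n with
  | zero => simp [shift, shiftFun]
  | succ n => rw [PowerSeries.coeff_succ_X_mul, coeff_powerSeries]; rfl

theorem powerSeries_shift_pow (n : ℕ) (x : ellTwo) :
    powerSeries ((shift ^ n) x) = PowerSeries.X ^ n * powerSeries x := by
  induction n with
  | zero => simp
  | succ n ih =>
    rw [pow_succ', LinearIsometry.coe_mul, Function.comp_apply, powerSeries_shift, ih, pow_succ', mul_assoc]

theorem shift_pow_apply_add (n : ℕ) (x : ellTwo) (m : ℕ) : (shift ^ n) x (m + n) = x m := by
  rw [← coeff_powerSeries, powerSeries_shift_pow, PowerSeries.coeff_X_pow_mul,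
    coeff_powerSeries]

theorem shift_pow_apply_of_lt {n m : ℕ} (h : m < n) (x : ellTwo) : (shift ^ n) x m = 0 := by
  rw [← coeff_powerSeries, powerSeries_shift_pow, PowerSeries.coeff_X_pow_mul',
    if_neg (by lia)]

/-- The standard unit vectors of `ℓ²(ℕ, ℂ)`. -/
abbrev unitVec (n : ℕ) : ellTwo := lp.single 2 n 1

theorem powerSeries_unitVec (n : ℕ) : powerSeries (unitVec n) = PowerSeries.X ^ n := by
  ext m
  rw [coeff_powerSeries, PowerSeries.coeff_X_pow, lp.single_apply, Pi.single_apply]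

theorem shift_pow_unitVec (n m : ℕ) : (shift ^ n) (unitVec m) = unitVec (n + m) := by
  apply powerSeries_injective
  rw [powerSeries_shift_pow, powerSeries_unitVec, powerSeries_unitVec, pow_add]

/-- Continuous linear maps on `ℓ²(ℕ, ℂ)` are determined by the unit vectors. -/
theorem clm_ext {F : Type*} [NormedAddCommGroup F] [NormedSpace ℂ F] {A B : ellTwo →L[ℂ] F}
    (h : ∀ n, A (unitVec n) = B (unitVec n)) : A = B := by
  apply lp.ext_continuousLinearMap (by norm_num)
  intro n
  ext
  simpa using h n

theorem powerSeries_map_of_unitVec {A : ellTwo →L[ℂ] ellTwo} {a : ellTwo}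
    (h : ∀ n, A (unitVec n) = (shift ^ n) a) (x : ellTwo) :
    powerSeries (A x) = powerSeries a * powerSeries x := by
  ext n
  let ev (i : ℕ) : ellTwo →L[ℂ] ℂ := lp.evalCLM ℂ (fun _ => ℂ) 2 i
  have key : ev n ∘L A = ∑ p ∈ Finset.HasAntidiagonal.antidiagonal n, a p.1 • ev p.2 := by
    apply clm_ext
    intro m
    have h1 : powerSeries (A (unitVec m)) = powerSeries a * powerSeries (unitVec m) := by
      rw [h, powerSeries_shift_pow, powerSeries_unitVec, mul_comm]
    have h2 := congrArg (PowerSeries.coeff n) h1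
    simp only [PowerSeries.coeff_mul, coeff_powerSeries] at h2
    simpa [ev, sum_apply] using! h2
  have := congrArg (fun L => L x) key
  simp only [PowerSeries.coeff_mul, coeff_powerSeries]
  simpa [ev, sum_apply] using! this

/-- The bilinear pairing `x ↦ ∑ₙ a(n) x(n)` as a continuous linear functional. -/
def pairing (a : ellTwo) : ellTwo →L[ℂ] ℂ := innerSL ℂ (star a)

theorem hasSum_pairing (a x : ellTwo) : HasSum (fun n => a n * x n) (pairing a x) := by
  have := lp.hasSum_inner (𝕜 := ℂ) (star a) x
  simpa [pairing, mul_comm] using this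

theorem pairing_unitVec (a : ellTwo) (n : ℕ) : pairing a (unitVec n) = a n := by
  simp [pairing, lp.inner_single_right]

theorem pairing_shift_pow (u g : ellTwo) (m : ℕ) :
    pairing u ((shift ^ m) g) = hankel u g m := by
  have h := hasSum_pairing u ((shift ^ m) g)
  rw [← hasSum_nat_add_iff' m, Finset.sum_eq_zero, sub_zero] at h
  · simp only [shift_pow_apply_add] at h
    exact h.tsum_eq.symm
  · intro i hi
    rw [shift_pow_apply_of_lt (Finset.mem_range.1 hi), mul_zero]

/-- If a vector `v` is not in the closed span of its images under the positive powers of an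
isometry `T`, then the closed span of its orbit contains a unit vector with orthonormal orbit,
obtained by projecting `v`. -/
theorem exists_orthonormal_orbit {H : Type*} [NormedAddCommGroup H] [InnerProductSpace ℂ H]
    [CompleteSpace H] (T : H →ₗᵢ[ℂ] H) (v : H)
    (hv : v ∉ (Submodule.span ℂ (Set.range fun n : ℕ => (T ^ (n + 1)) v)).topologicalClosure) :
    ∃ w ∈ (Submodule.span ℂ (Set.range fun n : ℕ => (T ^ n) v)).topologicalClosure,
      Orthonormal ℂ (fun n : ℕ => (T ^ n) w) ∧
      ∃ y ∈ (Submodule.span ℂ (Set.range fun n : ℕ => (T ^ (n + 1)) v)).topologicalClosure,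
        ∃ c : ℝ, ‖v‖⁻¹ ≤ c ∧ w = (c : ℂ) • (v - y) := by
  set M := (Submodule.span ℂ (Set.range fun n : ℕ => (T ^ n) v)).topologicalClosure
  set N := (Submodule.span ℂ (Set.range fun n : ℕ => (T ^ (n + 1)) v)).topologicalClosure
  have hNM : N ≤ M := by
    refine Submodule.topologicalClosure_mono (Submodule.span_mono ?_)
    rintro _ ⟨n, rfl⟩
    exact ⟨n + 1, rfl⟩
  have hvM : v ∈ M := Submodule.le_topologicalClosure _ (Submodule.subset_span ⟨0, by simp⟩)
  have hTM : M ≤ N.comap T.toLinearMap := by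
    refine Submodule.topologicalClosure_minimal _ (Submodule.span_le.2 ?_) ?_
    · rintro _ ⟨n, rfl⟩
      exact Submodule.le_topologicalClosure _
        (Submodule.subset_span ⟨n, by simp [pow_succ', LinearIsometry.coe_mul]⟩)
    · exact (Submodule.isClosed_topologicalClosure _).preimage T.continuous
  set y := N.starProjection v
  have hy : y ∈ N := N.starProjection_apply_mem v
  set z := v - y with hz
  have hzM : z ∈ M := M.sub_mem hvM (hNM hy)
  have hzN : z ∈ Nᗮ := N.sub_starProjection_mem_orthogonal v
  have hz0 : z ≠ 0 := fun h => hv (by rwa [sub_eq_zero.1 h])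
  have hzv : ‖z‖ ≤ ‖v‖ := by
    have h := norm_add_sq_eq_norm_sq_add_norm_sq_of_inner_eq_zero (𝕜 := ℂ) z y
      ((Submodule.mem_orthogonal' _ _).1 hzN y hy)
    rw [hz, sub_add_cancel, ← hz] at h
    nlinarith [norm_nonneg z, norm_nonneg v, norm_nonneg y]
  have hTz (n : ℕ) : (T ^ (n + 1)) z ∈ N := by
    induction n with
    | zero => simpa using hTM hzM
    | succ n ih =>
      rw [pow_succ', LinearIsometry.coe_mul]
      exact hTM (hNM ih)
  have horth (n k : ℕ) : inner ℂ ((T ^ n) z) ((T ^ (n + (k + 1))) z) = 0 := by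
    rw [pow_add, LinearIsometry.coe_mul, Function.comp_apply, LinearIsometry.inner_map_map]
    exact (Submodule.mem_orthogonal' _ _).1 hzN _ (hTz k)
  refine ⟨((‖z‖⁻¹ : ℝ) : ℂ) • z, M.smul_mem _ hzM, ⟨fun n => ?_, fun n m hnm => ?_⟩, y, hy, ‖z‖⁻¹,
    inv_anti₀ (norm_pos_iff.2 hz0) hzv, rfl⟩
  · rw [LinearIsometry.norm_map, norm_smul]
    simp [hz0]
  · simp only [map_smul, inner_smul_left, inner_smul_right]
    rcases lt_or_gt_of_ne hnm with h | h
    · obtain ⟨k, rfl⟩ := Nat.exists_eq_add_of_lt h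
      rw [add_assoc, horth]
      simp
    · obtain ⟨k, rfl⟩ := Nat.exists_eq_add_of_lt h
      rw [← inner_conj_symm, add_assoc, horth]
      simp

/-- The forward shift acting diagonally on pairs of sequences. -/
def shiftPair : WithLp 2 (ellTwo × ellTwo) →ₗᵢ[ℂ] WithLp 2 (ellTwo × ellTwo) :=
  shift.withLpProdMap 2 shift

theorem shiftPair_pow_apply (n : ℕ) (x : WithLp 2 (ellTwo × ellTwo)) :
    (shiftPair ^ n) x = WithLp.toLp 2 ((shift ^ n) x.fst, (shift ^ n) x.snd) := by
  induction n with
  | zero => rfl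
  | succ n ih =>
    rw [pow_succ', LinearIsometry.coe_mul, Function.comp_apply, ih, pow_succ']
    rfl

/-- A continuous linear map vanishing on a set vanishes on its closed span. -/
theorem eq_zero_of_mem_closure_span {E F ι : Type*} [NormedAddCommGroup E] [NormedSpace ℂ E]
    [NormedAddCommGroup F] [NormedSpace ℂ F] {s : ι → E} (L : E →L[ℂ] F) (hL : ∀ i, L (s i) = 0)
    {x : E} (hx : x ∈ (Submodule.span ℂ (Set.range s)).topologicalClosure) : L x = 0 := by
  have : (Submodule.span ℂ (Set.range s)).topologicalClosure ≤ L.ker := by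
    refine Submodule.topologicalClosure_minimal _ (Submodule.span_le.2 ?_) L.isClosed_ker
    rintro _ ⟨i, rfl⟩
    exact hL i
  exact this hx

/-- Every `g ∈ ℓ²` is a quotient of two bounded analytic multipliers: there is `φ`, with `φ(0)`
close to `1`, such that multiplication by `φ` is a contraction `A`, multiplication by `φ g` is a
bounded operator `B`, and `Γ_u` intertwines the transposes of `A` and `B`. -/
theorem exists_multiplier (g : ellTwo) {ε : ℝ} (hε : 0 < ε) :
    ∃ (φ : ellTwo) (A B : ellTwo →L[ℂ] ellTwo),
      (∀ x, powerSeries (A x) = powerSeries φ * powerSeries x) ∧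
      (∀ x, powerSeries (B x) = powerSeries φ * powerSeries g * powerSeries x) ∧
      (∀ x, ‖A x‖ ≤ ‖x‖) ∧
      (1 + ε * ‖g‖)⁻¹ ≤ (φ 0).re ∧
      ∀ u G : ellTwo, (G : ℕ → ℂ) = hankel u g → ∀ x, pairing u (B x) = pairing G (A x) := by
  set v : WithLp 2 (ellTwo × ellTwo) := WithLp.toLp 2 (unitVec 0, (ε : ℂ) • g) with hv
  have hv1 : v.fst = unitVec 0 := rfl
  have hv2 : v.snd = (ε : ℂ) • g := rfl
  let π₁ : WithLp 2 (ellTwo × ellTwo) →L[ℂ] ellTwo := WithLp.fstL 2 ℂ ellTwo ellTwo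
  let π₂ : WithLp 2 (ellTwo × ellTwo) →L[ℂ] ellTwo := WithLp.sndL 2 ℂ ellTwo ellTwo
  let ev : ellTwo →L[ℂ] ℂ := lp.evalCLM ℂ (fun _ => ℂ) 2 0
  have hfst (n : ℕ) (x) : ((shiftPair ^ n) x).fst = (shift ^ n) x.fst := by
    rw [shiftPair_pow_apply]; rfl
  have hsnd (n : ℕ) (x) : ((shiftPair ^ n) x).snd = (shift ^ n) x.snd := by
    rw [shiftPair_pow_apply]; rfl
  have hN : ∀ y ∈ (Submodule.span ℂ (Set.range fun n : ℕ =>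
      (shiftPair ^ (n + 1)) v)).topologicalClosure, y.fst 0 = 0 := by
    intro y hy
    refine eq_zero_of_mem_closure_span (ev ∘L π₁) (fun n => ?_) hy
    change ((shiftPair ^ (n + 1)) v).fst 0 = 0
    rw [hfst, shift_pow_apply_of_lt n.succ_pos]
  obtain ⟨w, hwM, hw, y, hy, c, hc, hwy⟩ := exists_orthonormal_orbit shiftPair v
    (fun h => by simpa [hv] using hN v h)
  let V := hw.orthogonalFamily.linearIsometry
  have hV (n : ℕ) : V (unitVec n) = (shiftPair ^ n) w := by
    simp [V, unitVec, OrthogonalFamily.linearIsometry_apply_single]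
  have hw2 : powerSeries w.snd = (ε : ℂ) • (powerSeries w.fst * powerSeries g) := by
    ext n
    rw [← sub_eq_zero, map_smul, PowerSeries.coeff_mul]
    simp only [coeff_powerSeries]
    let L : WithLp 2 (ellTwo × ellTwo) →L[ℂ] ℂ := lp.evalCLM ℂ (fun _ => ℂ) 2 n ∘L π₂ -
      (ε : ℂ) • ∑ p ∈ Finset.HasAntidiagonal.antidiagonal n,
        g p.2 • (lp.evalCLM ℂ (fun _ => ℂ) 2 p.1 ∘L π₁)
    have hL (x) : L x = x.snd n - (ε : ℂ) •
        ∑ p ∈ Finset.HasAntidiagonal.antidiagonal n, x.fst p.1 * g p.2 := by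
      simp only [mul_comm (x.fst _)]
      simp [L, π₁, π₂, sum_apply]
      rfl
    rw [← hL]
    refine eq_zero_of_mem_closure_span L (fun m => ?_) hwM
    rw [hL, hfst, hsnd, hv1, hv2]
    simp only [← coeff_powerSeries]
    rw [← PowerSeries.coeff_mul, ← map_smul, ← map_sub, powerSeries_shift_pow,
      powerSeries_shift_pow, powerSeries_unitVec, powerSeries_smul, pow_zero, mul_one, mul_smul_comm,
      sub_self, map_zero]
  have hε' : (ε : ℂ) ≠ 0 := by exact_mod_cast hε.ne'
  let A : ellTwo →L[ℂ] ellTwo := π₁ ∘L V.toContinuousLinearMap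
  let B : ellTwo →L[ℂ] ellTwo := (ε : ℂ)⁻¹ • (π₂ ∘L V.toContinuousLinearMap)
  have hA (n : ℕ) : A (unitVec n) = (shift ^ n) w.fst := by
    rw [← hfst, ← hV]; rfl
  have hB (n : ℕ) : B (unitVec n) = (shift ^ n) ((ε : ℂ)⁻¹ • w.snd) := by
    rw [map_smul, ← hsnd, ← hV]; rfl
  refine ⟨w.fst, A, B, powerSeries_map_of_unitVec hA, fun x => ?_, fun x => ?_, ?_,
    fun u G hG x => ?_⟩
  · rw [powerSeries_map_of_unitVec hB]
    rw [powerSeries_smul, hw2, smul_smul, inv_mul_cancel₀ hε', one_smul]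
  · exact (WithLp.norm_fst_le ..).trans_eq (V.norm_map x)
  · have hwc : w.fst 0 = c := by
      have : w.fst 0 = c * (v.fst 0 - y.fst 0) := by rw [hwy]; rfl
      rw [this, hN y hy, hv1, lp.single_apply_self, sub_zero, mul_one]
    rw [hwc, Complex.ofReal_re]
    refine le_trans (inv_anti₀ (norm_pos_iff.2 ?_) ?_) hc
    · intro h0
      simpa [hv] using congrArg (fun z => z.fst 0) h0
    · have : v = WithLp.toLp 2 (unitVec 0, 0) + WithLp.toLp 2 (0, (ε : ℂ) • g) := by
        rw [← WithLp.toLp_add]; simp [hv]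
      rw [this]
      refine (norm_add_le _ _).trans_eq ?_
      rw [WithLp.norm_toLp_fst, WithLp.norm_toLp_snd, norm_smul, lp.norm_single (by norm_num)]
      simp [abs_of_pos hε]
  · have : pairing u ∘L B = pairing G ∘L A := by
      apply clm_ext
      intro m
      rw [ContinuousLinearMap.comp_apply, ContinuousLinearMap.comp_apply, hA, hB, map_smul,
        map_smul, smul_eq_mul, inv_mul_eq_iff_eq_mul₀ hε', ← sub_eq_zero]
      refine eq_zero_of_mem_closure_span
        (pairing u ∘L (shift ^ m).toContinuousLinearMap ∘L π₂ -
          (ε : ℂ) • pairing G ∘L (shift ^ m).toContinuousLinearMap ∘L π₁) (fun n => ?_) hwM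
      change pairing u ((shift ^ m) ((shiftPair ^ n) v).snd) -
        (ε : ℂ) * pairing G ((shift ^ m) ((shiftPair ^ n) v).fst) = 0
      rw [hfst, hsnd]
      rw [hv1, hv2, map_smul, map_smul, map_smul, shift_pow_unitVec, shift_pow_unitVec,
        pairing_unitVec, ← Function.comp_apply (f := ⇑(shift ^ m)), ← LinearIsometry.coe_mul, ← pow_add,
        pairing_shift_pow, hG]
      simp
    exact congrArg (fun L => L x) this

/-- Contractive multipliers whose symbols `φ` satisfy `φ(0) → 1` converge strongly to `1`. -/
theorem tendsto_multiplier {φ : ℕ → ellTwo} {A : ℕ → ellTwo →L[ℂ] ellTwo} {c : ℕ → ℝ}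
    (hA : ∀ k x, powerSeries (A k x) = powerSeries (φ k) * powerSeries x)
    (hn : ∀ k x, ‖A k x‖ ≤ ‖x‖) (hφ : ∀ k, c k ≤ (φ k 0).re)
    (hc : Tendsto c atTop (nhds 1)) (x : ellTwo) :
    Tendsto (fun k => A k x) atTop (nhds x) := by
  have hunit (m : ℕ) : Tendsto (fun k => A k (unitVec m)) atTop (nhds (unitVec m)) := by
    rw [tendsto_iff_norm_sub_tendsto_zero]
    have hsq : Tendsto (fun k => Real.sqrt (2 - 2 * c k)) atTop (nhds 0) := by
      have := ((hc.const_mul 2).const_sub 2).sqrt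
      simpa using this
    refine squeeze_zero (fun _ => norm_nonneg _) (fun k => Real.le_sqrt_of_sq_le ?_) hsq
    have hm : A k (unitVec m) m = φ k 0 := by
      rw [← coeff_powerSeries, hA, powerSeries_unitVec, PowerSeries.coeff_mul_X_pow',
        if_pos le_rfl, Nat.sub_self, coeff_powerSeries]
    have h1 : ‖unitVec m‖ = 1 := by
      rw [lp.norm_single (by norm_num), norm_one]
    have h2 := hn k (unitVec m)
    rw [norm_sub_sq (𝕜 := ℂ), lp.inner_single_right, hm, h1]
    rw [h1] at h2
    have h3 : RCLike.re (inner ℂ (φ k 0) (1 : ℂ)) = (φ k 0).re := by simp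
    rw [h3]
    nlinarith [hφ k, norm_nonneg (A k (unitVec m))]
  have hclosed : IsClosed {y : ellTwo | Tendsto (fun k => A k y) atTop (nhds y)} := by
    refine Equicontinuous.isClosed_setOfPred_tendsto ?_ continuous_id
    refine (LipschitzWith.uniformEquicontinuous (fun k => ⇑(A k)) 1 fun k => ?_).equicontinuous
    exact AddMonoidHomClass.lipschitz_of_bound_nnnorm (A k) 1 fun y => by
      rw [one_mul]; exact hn k y
  refine hclosed.mem_of_tendsto (lp.hasSum_single (by norm_num) x)
    (Eventually.of_forall fun s => ?_)
  simp only [Set.mem_ofPred_eq, map_sum]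
  refine tendsto_finsetSum _ fun i _ => ?_
  have : lp.single 2 i (x i) = x i • unitVec i := by
    rw [← lp.single_smul, smul_eq_mul, mul_one]
  rw [this]
  simp only [map_smul]
  exact (hunit i).const_smul _

/-- Maximal Hankel operators are symmetric for the bilinear pairing. -/
theorem pairing_hankel_comm {u g k G K : ellTwo} (hG : (G : ℕ → ℂ) = hankel u g)
    (hK : (K : ℕ → ℂ) = hankel u k) : pairing G k = pairing K g := by
  have hpos (n : ℕ) : (0 : ℝ) < 1 / (n + 1) := Nat.one_div_pos_of_nat
  have hlim (a : ℝ) : Tendsto (fun n : ℕ => (1 + 1 / ((n : ℝ) + 1) * a)⁻¹) atTop (nhds 1) := by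
    have := ((tendsto_one_div_add_atTop_nhds_zero_nat (𝕜 := ℝ)).mul_const a).const_add 1
    simpa using this.inv₀ (by simp)
  choose φ₁ A₁ B₁ hA₁ hB₁ hn₁ hφ₁ hp₁ using fun n => exists_multiplier g (hpos n)
  choose φ₂ A₂ B₂ hA₂ hB₂ hn₂ hφ₂ hp₂ using fun n => exists_multiplier k (hpos n)
  have ht₁ := tendsto_multiplier hA₁ hn₁ hφ₁ (hlim _)
  have ht₂ := tendsto_multiplier hA₂ hn₂ hφ₂ (hlim _)
  have ht (x : ellTwo) : Tendsto (fun n => A₁ n (A₂ n x)) atTop (nhds x) := by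
    have h0 : Tendsto (fun n => A₁ n (A₂ n x - x)) atTop (nhds 0) :=
      squeeze_zero_norm (fun n => hn₁ n _) (tendsto_iff_norm_sub_tendsto_zero.1 (ht₂ x))
    simpa using h0.add (ht₁ x)
  have key (n : ℕ) : pairing G (A₁ n (A₂ n k)) = pairing K (A₁ n (A₂ n g)) := by
    have e₁ : A₁ n (A₂ n k) = A₁ n (B₂ n (unitVec 0)) := by
      apply powerSeries_injective
      rw [hA₁, hA₁, hA₂, hB₂, powerSeries_unitVec, pow_zero, mul_one]
    have e₂ : A₁ n (A₂ n g) = A₂ n (B₁ n (unitVec 0)) := by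
      apply powerSeries_injective
      rw [hA₁, hA₂, hA₂, hB₁, powerSeries_unitVec]
      ring
    have e₃ : B₁ n (B₂ n (unitVec 0)) = B₂ n (B₁ n (unitVec 0)) := by
      apply powerSeries_injective
      rw [hB₁, hB₂, hB₂, hB₁]
      ring
    rw [e₁, e₂, ← hp₁ n u G hG, ← hp₂ n u K hK, e₃]
  refine tendsto_nhds_unique (((pairing G).continuous.tendsto _).comp (ht k)) ?_
  simpa only [Function.comp_def, key] using ((pairing K).continuous.tendsto _).comp (ht g)

theorem ip_eq_pairing (a x : ellTwo) : ip a x = pairing a (star x) :=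
  (hasSum_pairing a (star x)).tsum_eq

theorem hankel_sharp (u f : ℕ → ℂ) : hankel (sharp u) f = star (hankel u (star f)) := by
  ext n
  simp [hankel, sharp, Complex.conj_tsum]

/-- The adjoint of the maximal Hankel operator `Γ_u` is `Γ_{u♯}`: for `f, h ∈ ℓ²`,
`⟨Γ_u g, f⟩ = ⟨g, h⟩` for all `g ∈ Dom Γ_u` iff `f ∈ Dom Γ_{u♯}` and `Γ_{u♯} f = h`. -/
theorem stmt_3 (u : ellTwo) (f h : ellTwo) :
    (∀ g : ellTwo, Memℓp (hankel (⇑u) (⇑g)) 2 →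
        ip (hankel (⇑u) (⇑g)) (⇑f) = ip (⇑g) (⇑h)) ↔
      (Memℓp (hankel (sharp (⇑u)) (⇑f)) 2 ∧ hankel (sharp (⇑u)) (⇑f) = ⇑h) := by
  rw [hankel_sharp]
  constructor
  · intro H
    have key : star (hankel u (star f)) = h := by
      ext n
      have hu : hankel u (unitVec n) = fun m => u (n + m) := by
        ext m
        rw [← pairing_shift_pow, shift_pow_unitVec, pairing_unitVec, add_comm]
      have hmem : Memℓp (hankel u (unitVec n)) 2 := by
        have := (summable_nat_add_iff n).2 (summable_norm_sq u)
        rw [memℓp_gen_iff (by norm_num), hu]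
        simpa [add_comm] using this
      have h1 := H (unitVec n) hmem
      have h2 : ip (hankel u (unitVec n)) f = hankel u (star f) n := by
        rw [hu]
        simp only [ip, hankel, add_comm n]
        rfl
      have h3 : ip (unitVec n) h = star (h n) := by
        rw [ip, tsum_eq_single n fun m hm => by rw [lp.single_apply_ne _ _ _ hm, zero_mul],
          lp.single_apply_self, one_mul]
        rfl
      rw [h2, h3] at h1
      rw [Pi.star_apply, h1, star_star]
    exact ⟨key ▸ lp.memℓp h, key⟩
  · rintro ⟨-, H⟩ g hg
    have hK : ((star h : ellTwo) : ℕ → ℂ) = hankel u (star f : ellTwo) := by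
      rw [lp.coeFn_star, ← H, star_star, lp.coeFn_star]
    have h1 := pairing_hankel_comm (u := u) (G := ⟨hankel u g, hg⟩) rfl hK
    rw [ip_eq_pairing g h]
    refine (ip_eq_pairing ⟨hankel u g, hg⟩ f).trans (h1.trans ?_)
    rw [← (hasSum_pairing _ _).tsum_eq, ← (hasSum_pairing _ _).tsum_eq]
    simp only [mul_comm]
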